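/- Let A and B be convex bodies in R^d, L a linear hyperplane, and let M and N be the maximal (d-1)-volumes of sections of A and B respectively by affine hyperplanes parallel to L. Then for all α, β > 0: μ_d(αA + βB) ≥ (α M^{1/(d-1)} + β N^{1/(d-1)})^{d-1} · (α μ_d(A)/M + β μ_d(B)/N). -/

import Mathlib

open MeasureTheory Pointwise
open scoped RealInnerProductSpace

/-- The Brunn–Minkowski inequality for a measure `μ`, with exponent `1 / n`. -/
def BrunnMinkowski {E : Type*} [TopologicalSpace E] [Add E] [MeasurableSpace E]
    (μ : Measure E) (n : ℝ) : Prop :=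
  ∀ K L : Set E, IsCompact K → IsCompact L → K.Nonempty → L.Nonempty →
    μ.real K ^ (1 / n) + μ.real L ^ (1 / n) ≤ μ.real (K + L) ^ (1 / n)

theorem IsCompact.volume_add_le {K L : Set ℝ} (hK : IsCompact K) (hL : IsCompact L)
    (hK0 : K.Nonempty) (hL0 : L.Nonempty) : volume K + volume L ≤ volume (K + L) := by
  obtain ⟨a, haK, ha⟩ := hK.exists_isGreatest hK0
  obtain ⟨b, hbL, hb⟩ := hL.exists_isLeast hL0
  have hsub : (fun x => b + x) '' K ∪ (fun x => a + x) '' L ⊆ K + L := by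
    rintro _ (⟨x, hx, rfl⟩ | ⟨x, hx, rfl⟩)
    · exact ⟨x, hx, b, hbL, add_comm _ _⟩
    · exact ⟨a, haK, x, hx, rfl⟩
  have hdisj : AEDisjoint volume ((fun x => b + x) '' K) ((fun x => a + x) '' L) := by
    refine measure_mono_null (t := {a + b}) ?_ (by simp)
    rintro _ ⟨⟨x, hx, rfl⟩, y, hy, hxy⟩
    have h1 := ha hx
    have h2 := hb hy
    simp only [Set.mem_singleton_iff] at *
    linarith
  calc volume K + volume L
      = volume ((fun x => b + x) '' K) + volume ((fun x => a + x) '' L) := by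
        simp [Set.image_add_left, measure_preimage_add]
    _ = volume ((fun x => b + x) '' K ∪ (fun x => a + x) '' L) :=
        (measure_union₀ (hL.image (by fun_prop)).measurableSet.nullMeasurableSet hdisj).symm
    _ ≤ _ := measure_mono hsub

theorem MeasurableSet.volume_add_le_of_add_subset {S T U : Set ℝ} (hS : MeasurableSet S)
    (hT : MeasurableSet T) (hS0 : S.Nonempty) (hT0 : T.Nonempty) (h : S + T ⊆ U) :
    volume S + volume T ≤ volume U := by
  obtain ⟨s, hs⟩ := hS0
  obtain ⟨t, ht⟩ := hT0
  rw [hS.measure_eq_iSup_isCompact, hT.measure_eq_iSup_isCompact]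
  simp only [iSup_and']
  refine ENNReal.biSup_add_biSup_le' ⟨∅, Set.empty_subset _, isCompact_empty⟩
    ⟨∅, Set.empty_subset _, isCompact_empty⟩ fun K hK L hL => ?_
  calc volume K + volume L ≤ volume (insert s K) + volume (insert t L) := by
        gcongr <;> exact Set.subset_insert _ _
    _ ≤ volume (insert s K + insert t L) :=
        (hK.2.insert s).volume_add_le (hL.2.insert t) (Set.insert_nonempty _ _)
          (Set.insert_nonempty _ _)
    _ ≤ volume U := measure_mono ((Set.add_subset_add (Set.insert_subset hs hK.1)
        (Set.insert_subset ht hL.1)).trans h)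

/-- One-dimensional Prékopa–Leindler type inequality for functions with supremum `1`. -/
theorem lintegral_add_le_of_lt_add {f g k : ℝ → ℝ} (hf : Measurable f) (hg : Measurable g)
    (hk : Measurable k) (hf0 : 0 ≤ f) (hg0 : 0 ≤ g) (hk0 : 0 ≤ k)
    (hf1 : IsLUB (Set.range f) 1) (hg1 : IsLUB (Set.range g) 1)
    (h : ∀ s x y, 0 < s → s < f x → s < g y → s < k (x + y)) :
    (∫⁻ x, ENNReal.ofReal (f x)) + (∫⁻ x, ENNReal.ofReal (g x)) ≤ ∫⁻ x, ENNReal.ofReal (k x) := by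
  have hmeas : ∀ {F : ℝ → ℝ}, Measurable fun t => volume {x | t < F x} := fun {F} =>
    Antitone.measurable fun a b hab => measure_mono fun x hx => lt_of_le_of_lt hab hx
  rw [lintegral_eq_lintegral_meas_lt _ (.of_forall hf0) hf.aemeasurable,
    lintegral_eq_lintegral_meas_lt _ (.of_forall hg0) hg.aemeasurable,
    lintegral_eq_lintegral_meas_lt _ (.of_forall hk0) hk.aemeasurable,
    ← lintegral_add_left hmeas]
  refine setLIntegral_mono hmeas fun s hs => ?_
  rcases lt_or_ge s 1 with hs1 | hs1
  · have hne : ∀ {F : ℝ → ℝ}, IsLUB (Set.range F) 1 → {x | s < F x}.Nonempty := fun hF => by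
      obtain ⟨_, ⟨x, rfl⟩, hx, -⟩ := hF.exists_between hs1
      exact ⟨x, hx⟩
    refine (measurableSet_lt measurable_const hf).volume_add_le_of_add_subset
      (measurableSet_lt measurable_const hg) (hne hf1) (hne hg1) ?_
    rintro _ ⟨x, hx, y, hy, rfl⟩
    exact h s x y hs hx hy
  · have hem : ∀ {F : ℝ → ℝ}, IsLUB (Set.range F) 1 → {x | s < F x} = ∅ := fun hF => by
      ext x
      simpa using (hF.1 ⟨x, rfl⟩).trans hs1
    simp [hem hf1, hem hg1]

theorem IsCompact.prodMk_preimage {F : Type*} [TopologicalSpace F] [T2Space F] {A : Set (ℝ × F)}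
    (hA : IsCompact A) (t : ℝ) : IsCompact (Prod.mk t ⁻¹' A) :=
  (Topology.IsClosedEmbedding.of_continuous_injective_isClosedMap
    (by fun_prop) (Prod.mk_right_injective t) (isClosedMap_prodMk_left t)).isCompact_preimage hA

theorem IsCompact.exists_isLUB_slice {F : Type*} [TopologicalSpace F] [MeasurableSpace F]
    (ν : Measure F) [IsFiniteMeasureOnCompacts ν] {A : Set (ℝ × F)} (hA : IsCompact A) :
    ∃ M, IsLUB (Set.range fun t : ℝ => ν.real (Prod.mk t ⁻¹' A)) M := by
  refine Real.exists_isLUB (Set.range_nonempty _) ⟨ν.real (Prod.snd '' A), ?_⟩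
  rintro _ ⟨t, rfl⟩
  exact measureReal_mono (fun v hv => ⟨(t, v), hv, rfl⟩) (hA.image continuous_snd).measure_ne_top

section Product

variable {F : Type*} [NormedAddCommGroup F] [MeasurableSpace F] [BorelSpace F]

variable [SecondCountableTopology F] (ν : Measure F) [IsFiniteMeasureOnCompacts ν] [SFinite ν]

theorem IsCompact.lintegral_slice {A : Set (ℝ × F)} (hA : IsCompact A) {M : ℝ} (hM : 0 < M) :
    ∫⁻ t, ENNReal.ofReal (ν.real (Prod.mk t ⁻¹' A) / M)
      = ENNReal.ofReal ((volume.prod ν).real A / M) := by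
  have h : ∀ t, ENNReal.ofReal (ν.real (Prod.mk t ⁻¹' A) / M)
      = ν (Prod.mk t ⁻¹' A) / ENNReal.ofReal M := fun t => by
    rw [ENNReal.ofReal_div_of_pos hM, ofReal_measureReal (hA.prodMk_preimage t).measure_ne_top]
  rw [ENNReal.ofReal_div_of_pos hM, ofReal_measureReal hA.measure_ne_top,
    Measure.prod_apply hA.measurableSet]
  simp_rw [h, div_eq_mul_inv]
  rw [lintegral_mul_const _ (measurable_measure_prodMk_left hA.measurableSet)]

/-- Bonnesen's inequality in a product, with sections by the second factor. -/
theorem BrunnMinkowski.bonnesen_prod {n : ℝ} (hn : 0 < n) (hν : BrunnMinkowski ν n)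
    {A B : Set (ℝ × F)} (hA : IsCompact A) (hB : IsCompact B) {M N : ℝ} (hM0 : 0 < M) (hN0 : 0 < N)
    (hM : IsLUB (Set.range fun t : ℝ => ν.real (Prod.mk t ⁻¹' A)) M)
    (hN : IsLUB (Set.range fun t : ℝ => ν.real (Prod.mk t ⁻¹' B)) N) :
    (M ^ (1 / n) + N ^ (1 / n)) ^ n *
        ((volume.prod ν).real A / M + (volume.prod ν).real B / N) ≤
      (volume.prod ν).real (A + B) := by
  set C := (M ^ (1 / n) + N ^ (1 / n)) ^ n with hC
  have hC0 : 0 < C := by positivity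
  have hmeas : ∀ {S : Set (ℝ × F)}, IsCompact S → ∀ c : ℝ,
      Measurable fun t => ν.real (Prod.mk t ⁻¹' S) / c := fun hS c =>
    (measurable_measure_prodMk_left hS.measurableSet).ennreal_toReal.div_const c
  have hlub : ∀ {S : Set (ℝ × F)} {c : ℝ}, 0 < c →
      IsLUB (Set.range fun t : ℝ => ν.real (Prod.mk t ⁻¹' S)) c →
      IsLUB (Set.range fun t : ℝ => ν.real (Prod.mk t ⁻¹' S) / c) 1 := fun {S c} hc h => by
    constructor
    · rintro _ ⟨t, rfl⟩
      exact (div_le_one hc).2 (h.1 ⟨t, rfl⟩)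
    · intro b hb
      rw [← mul_le_mul_iff_left₀ hc, one_mul]
      refine h.2 ?_
      rintro _ ⟨t, rfl⟩
      exact (div_le_iff₀ hc).1 (hb ⟨t, rfl⟩)
  have key := lintegral_add_le_of_lt_add (hmeas hA M) (hmeas hB N) (hmeas (hA.add hB) C)
    (fun t => by positivity) (fun t => by positivity) (fun t => by positivity)
    (hlub hM0 hM) (hlub hN0 hN) ?_
  · rw [hA.lintegral_slice ν hM0, hB.lintegral_slice ν hN0, (hA.add hB).lintegral_slice ν hC0,
      ← ENNReal.ofReal_add (by positivity) (by positivity),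
      ENNReal.ofReal_le_ofReal_iff (by positivity), le_div_iff₀ hC0] at key
    linarith
  · intro s x y hs hx hy
    rw [lt_div_iff₀ hM0] at hx
    rw [lt_div_iff₀ hN0] at hy
    rw [lt_div_iff₀ hC0]
    have hne : ∀ {S : Set F} {c : ℝ}, 0 < c → s * c < ν.real S → S.Nonempty := fun {S c} hc h => by
      by_contra hS
      rw [Set.not_nonempty_iff_eq_empty] at hS
      rw [hS, measureReal_empty] at h
      exact absurd h (by positivity : 0 < s * c).le.not_gt
    have hsub : Prod.mk x ⁻¹' A + Prod.mk y ⁻¹' B ⊆ Prod.mk (x + y) ⁻¹' (A + B) := by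
      rintro _ ⟨v, hv, w, hw, rfl⟩
      exact ⟨(x, v), hv, (y, w), hw, rfl⟩
    have h1 := hν _ _ (hA.prodMk_preimage x) (hB.prodMk_preimage y) (hne hM0 hx) (hne hN0 hy)
    have h2 : ν.real (Prod.mk x ⁻¹' A + Prod.mk y ⁻¹' B) ≤ ν.real (Prod.mk (x + y) ⁻¹' (A + B)) :=
      measureReal_mono hsub ((hA.add hB).prodMk_preimage _).measure_ne_top
    refine lt_of_lt_of_le ?_ h2
    rw [← Real.rpow_lt_rpow_iff (by positivity) (by positivity) (one_div_pos.2 hn)]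
    refine lt_of_lt_of_le ?_ h1
    have h3 : (s * C) ^ (1 / n) = (s * M) ^ (1 / n) + (s * N) ^ (1 / n) := by
      rw [Real.mul_rpow hs.le hC0.le, hC, ← Real.rpow_mul (by positivity), mul_one_div_cancel hn.ne',
        Real.rpow_one, Real.mul_rpow hs.le hM0.le, Real.mul_rpow hs.le hN0.le]
      ring
    rw [h3]
    gcongr

/-- The maximal section of a compact set of positive measure is positive. -/
theorem IsCompact.slice_lub_pos {A : Set (ℝ × F)} (hA : IsCompact A)
    (hA0 : (volume.prod ν) A ≠ 0) {M : ℝ}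
    (hM : M ∈ upperBounds (Set.range fun t : ℝ => ν.real (Prod.mk t ⁻¹' A))) : 0 < M := by
  by_contra hM0
  refine hA0 ?_
  rw [Measure.prod_apply hA.measurableSet]
  have : ∀ t, ν (Prod.mk t ⁻¹' A) = 0 := fun t => by
    have := (hM ⟨t, rfl⟩).trans (not_lt.1 hM0)
    rw [← measureReal_eq_zero_iff (hA.prodMk_preimage t).measure_ne_top]
    exact le_antisymm this measureReal_nonneg
  simp [this]

end Product

theorem rpow_add_rpow_le_of_holder {n a b M N : ℝ} (hn : 0 < n) (ha : 0 ≤ a) (hb : 0 ≤ b)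
    (hM : 0 < M) (hN : 0 < N) :
    a ^ (1 / (n + 1)) + b ^ (1 / (n + 1)) ≤
      ((M ^ (1 / n) + N ^ (1 / n)) ^ n * (a / M + b / N)) ^ (1 / (n + 1)) := by
  have hconj : ((n + 1) / n).HolderConjugate (n + 1) := by
    rw [Real.holderConjugate_iff]
    constructor
    · rw [lt_div_iff₀ hn]; linarith
    · field_simp
  have h := Real.inner_le_Lp_mul_Lq (Finset.univ : Finset (Fin 2))
    ![M ^ (1 / (n + 1)), N ^ (1 / (n + 1))] ![(a / M) ^ (1 / (n + 1)), (b / N) ^ (1 / (n + 1))] hconj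
  simp only [Fin.sum_univ_two, Matrix.cons_val_zero, Matrix.cons_val_one] at h
  have e1 : ∀ {x y : ℝ}, 0 < x → 0 ≤ y →
      x ^ (1 / (n + 1)) * (y / x) ^ (1 / (n + 1)) = y ^ (1 / (n + 1)) := fun {x y} hx hy => by
    rw [← Real.mul_rpow hx.le (by positivity), mul_div_cancel₀ _ hx.ne']
  have e2 : ∀ {x : ℝ}, 0 < x → |x ^ (1 / (n + 1))| ^ ((n + 1) / n) = x ^ (1 / n) := fun {x} hx => by
    rw [abs_of_nonneg (by positivity), ← Real.rpow_mul hx.le]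
    congr 1; field_simp
  have e3 : ∀ {x : ℝ}, 0 ≤ x → |x ^ (1 / (n + 1))| ^ (n + 1) = x := fun {x} hx => by
    rw [abs_of_nonneg (by positivity), ← Real.rpow_mul hx, one_div_mul_cancel (by positivity),
      Real.rpow_one]
  rw [e1 hM ha, e1 hN hb, e2 hM, e2 hN, e3 (by positivity), e3 (by positivity)] at h
  refine h.trans_eq ?_
  rw [Real.mul_rpow (by positivity) (by positivity), ← Real.rpow_mul (by positivity)]
  congr 2
  field_simp

theorem BrunnMinkowski.prod {F : Type*} [NormedAddCommGroup F] [NormedSpace ℝ F]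
    [MeasurableSpace F] [BorelSpace F] [FiniteDimensional ℝ F] (ν : Measure F)
    [ν.IsAddHaarMeasure] {n : ℝ} (hn : 0 < n)
    (hν : BrunnMinkowski ν n) : BrunnMinkowski ((volume : Measure ℝ).prod ν) (n + 1) := by
  intro A B hA hB hA0 hB0
  have : ProperSpace F := FiniteDimensional.proper ℝ F
  have hpos : (0 : ℝ) < 1 / (n + 1) := by positivity
  have hAB := (hA.add hB).measure_ne_top (μ := (volume : Measure ℝ).prod ν)
  by_cases hAz : ((volume : Measure ℝ).prod ν) A = 0
  · obtain ⟨a, ha⟩ := hA0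
    rw [measureReal_def, hAz, ENNReal.toReal_zero, Real.zero_rpow hpos.ne', zero_add]
    refine Real.rpow_le_rpow measureReal_nonneg ?_ hpos.le
    rw [measureReal_def, ← measure_preimage_add _ (-a) B]
    refine measureReal_mono (fun x hx => ⟨a, ha, _, hx, by simp⟩) hAB
  by_cases hBz : ((volume : Measure ℝ).prod ν) B = 0
  · obtain ⟨b, hb⟩ := hB0
    rw [measureReal_def _ B, hBz, ENNReal.toReal_zero, Real.zero_rpow hpos.ne', add_zero]
    refine Real.rpow_le_rpow measureReal_nonneg ?_ hpos.le
    rw [measureReal_def, ← measure_preimage_add _ (-b) A]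
    refine measureReal_mono (fun x hx => ⟨_, hx, b, hb, by simp⟩) hAB
  obtain ⟨M, hM⟩ := hA.exists_isLUB_slice ν
  obtain ⟨N, hN⟩ := hB.exists_isLUB_slice ν
  have hM0 := hA.slice_lub_pos ν hAz hM.1
  have hN0 := hB.slice_lub_pos ν hBz hN.1
  exact (rpow_add_rpow_le_of_holder hn measureReal_nonneg measureReal_nonneg hM0 hN0).trans
    (Real.rpow_le_rpow (by positivity) (hν.bonnesen_prod ν hn hA hB hM0 hN0 hM hN) hpos.le)

theorem ContinuousLinearEquiv.preimage_add {E F : Type*} [AddCommGroup E] [Module ℝ E]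
    [TopologicalSpace E] [AddCommGroup F] [Module ℝ F] [TopologicalSpace F] (e : E ≃L[ℝ] F)
    (S T : Set F) :
    e ⁻¹' (S + T) = e ⁻¹' S + e ⁻¹' T := by
  simp_rw [← e.image_symm_eq_preimage]
  exact Set.image_add e.symm

section Transfer

variable {E F : Type*} [NormedAddCommGroup E] [NormedSpace ℝ E] [MeasurableSpace E] [BorelSpace E]
  [NormedAddCommGroup F] [NormedSpace ℝ F] [MeasurableSpace F]
  [BorelSpace F] [FiniteDimensional ℝ F]

theorem ContinuousLinearEquiv.exists_measureReal_eq (e : E ≃L[ℝ] F) (μ : Measure E)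
    [μ.IsAddHaarMeasure] (ν : Measure F) [ν.IsAddHaarMeasure] :
    ∃ c : ℝ, 0 < c ∧ ∀ S, ν.real S = c * μ.real (e ⁻¹' S) := by
  have := e.isAddHaarMeasure_map μ
  have h := Measure.isAddLeftInvariant_eq_smul ν (Measure.map e μ)
  refine ⟨_, NNReal.coe_pos.2 (Measure.addHaarScalarFactor_pos_of_isAddHaarMeasure ν
    (Measure.map e μ)), fun S => ?_⟩
  have hS : Measure.map e μ S = μ (e ⁻¹' S) :=
    e.toHomeomorph.toMeasurableEquiv.map_apply S
  have h' := congrArg (fun m => (m S).toReal) h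
  simpa [measureReal_def, hS] using h'

theorem BrunnMinkowski.of_equiv (e : E ≃L[ℝ] F) (μ : Measure E) [μ.IsAddHaarMeasure]
    (ν : Measure F) [ν.IsAddHaarMeasure] {n : ℝ} (h : BrunnMinkowski μ n) :
    BrunnMinkowski ν n := by
  intro K L hK hL hK0 hL0
  obtain ⟨c, hc, H⟩ := e.exists_measureReal_eq μ ν
  have hcomp : ∀ {S : Set F}, IsCompact S → IsCompact (e ⁻¹' S) := fun hS =>
    e.toHomeomorph.isCompact_preimage.2 hS
  simp only [H, Real.mul_rpow hc.le measureReal_nonneg, e.preimage_add, ← mul_add]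
  gcongr
  exact h _ _ (hcomp hK) (hcomp hL) (hK0.preimage e.surjective) (hL0.preimage e.surjective)

end Transfer

theorem brunnMinkowski_real : BrunnMinkowski (volume : Measure ℝ) 1 := by
  intro K L hK hL hK0 hL0
  simp only [div_one, Real.rpow_one, measureReal_def]
  rw [← ENNReal.toReal_add hK.measure_ne_top hL.measure_ne_top]
  exact ENNReal.toReal_mono (hK.add hL).measure_ne_top (hK.volume_add_le hL hK0 hL0)

theorem brunnMinkowski_of_finrank (n : ℕ) {E : Type*} [NormedAddCommGroup E] [NormedSpace ℝ E]
    [MeasurableSpace E] [BorelSpace E] [FiniteDimensional ℝ E] (μ : Measure E)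
    [μ.IsAddHaarMeasure] (hE : Module.finrank ℝ E = n + 1) : BrunnMinkowski μ (n + 1) := by
  suffices h : BrunnMinkowski (volume : Measure (Fin (n + 1) → ℝ)) (n + 1) from
    h.of_equiv (ContinuousLinearEquiv.ofFinrankEq (by simp [hE])) _ _
  clear hE
  induction n with
  | zero =>
    have := brunnMinkowski_real.of_equiv (F := Fin 1 → ℝ)
      (ContinuousLinearEquiv.ofFinrankEq (by simp)) _ volume
    simpa using this
  | succ n ih =>
    have h := (ih.prod volume (by positivity)).of_equiv (F := Fin (n + 1 + 1) → ℝ)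
      (ContinuousLinearEquiv.ofFinrankEq (by simp [add_comm])) _ volume
    simpa using h

theorem isLUB_slice_smul {F : Type*} [NormedAddCommGroup F] [NormedSpace ℝ F] [MeasurableSpace F]
    [BorelSpace F] [FiniteDimensional ℝ F] (ν : Measure F) [ν.IsAddHaarMeasure]
    {A : Set (ℝ × F)} {M r : ℝ} (hr : 0 < r)
    (hM : IsLUB (Set.range fun t : ℝ => ν.real (Prod.mk t ⁻¹' A)) M) :
    IsLUB (Set.range fun t : ℝ => ν.real (Prod.mk t ⁻¹' (r • A)))
      (r ^ Module.finrank ℝ F * M) := by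
  have hp : 0 < r ^ Module.finrank ℝ F := by positivity
  have hs : ∀ t, ν.real (Prod.mk (r * t) ⁻¹' (r • A))
      = r ^ Module.finrank ℝ F * ν.real (Prod.mk t ⁻¹' A) := fun t => by
    have : Prod.mk (r * t) ⁻¹' (r • A) = r • (Prod.mk t ⁻¹' A) := by
      ext v
      simp [Set.mem_smul_set_iff_inv_smul_mem₀ hr.ne', hr.ne']
    rw [this, measureReal_def, Measure.addHaar_smul, ENNReal.toReal_mul,
      ENNReal.toReal_ofReal (abs_nonneg _), abs_of_pos hp, measureReal_def]
  have hs' : ∀ t, ν.real (Prod.mk t ⁻¹' (r • A))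
      = r ^ Module.finrank ℝ F * ν.real (Prod.mk (r⁻¹ * t) ⁻¹' A) := fun t => by
    rw [← hs, mul_inv_cancel_left₀ hr.ne']
  constructor
  · rintro _ ⟨t, rfl⟩
    simp only [hs']
    exact mul_le_mul_of_nonneg_left (hM.1 ⟨_, rfl⟩) hp.le
  · intro b hb
    rw [← le_div_iff₀' hp]
    refine hM.2 ?_
    rintro _ ⟨t, rfl⟩
    rw [le_div_iff₀' hp]
    have := hb ⟨r * t, rfl⟩
    simpa only [hs] using this

section Hyperplane

variable {E : Type*} [NormedAddCommGroup E] [InnerProductSpace ℝ E]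

/-- The splitting of a Euclidean space along a unit vector. -/
noncomputable def splitUnit [FiniteDimensional ℝ E] (u : E) (hu : ‖u‖ = 1) :
    (ℝ × (ℝ ∙ u)ᗮ) ≃L[ℝ] E :=
  (LinearEquiv.ofBijective
    ((LinearMap.toSpanSingleton ℝ E u).coprod (ℝ ∙ u)ᗮ.subtype) (by
      have hv : ∀ v : (ℝ ∙ u)ᗮ, ⟪u, (v : E)⟫ = 0 := fun v =>
        Submodule.mem_orthogonal_singleton_iff_inner_right.1 v.2
      constructor
      · rw [← LinearMap.ker_eq_bot, LinearMap.ker_eq_bot']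
        rintro ⟨t, v⟩ h
        have h' : t • u + (v : E) = 0 := by simpa using h
        have ht : t = 0 := by
          have := congrArg (fun x => ⟪u, x⟫) h'
          simpa [inner_add_right, inner_smul_right, hv, hu] using this
        subst ht
        simpa using h'
      · intro x
        refine ⟨(⟪u, x⟫, ⟨x - ⟪u, x⟫ • u, ?_⟩), by simp⟩
        rw [Submodule.mem_orthogonal_singleton_iff_inner_right]
        simp [inner_sub_right, inner_smul_right, hu])).toContinuousLinearEquiv

theorem splitUnit_apply [FiniteDimensional ℝ E] (u : E) (hu : ‖u‖ = 1) (t : ℝ) (v : (ℝ ∙ u)ᗮ) :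
    splitUnit u hu (t, v) = t • u + v := rfl

theorem hausdorffMeasure_slice [FiniteDimensional ℝ E] [MeasurableSpace E] [BorelSpace E] (u : E)
    (hu : ‖u‖ = 1) {s : ℝ} (hs : 0 ≤ s) (A : Set E) (t : ℝ) :
    μH[s] (A ∩ {x | ⟪x, u⟫ = t})
      = μH[s] (Prod.mk t ⁻¹' (splitUnit u hu ⁻¹' A) : Set (ℝ ∙ u)ᗮ) := by
  have hiso : Isometry fun v : (ℝ ∙ u)ᗮ => t • u + (v : E) :=
    (IsometryEquiv.addLeft (t • u)).isometry.comp isometry_subtype_coe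
  have hinner : ∀ (r : ℝ) (v : (ℝ ∙ u)ᗮ), ⟪r • u + (v : E), u⟫ = r := fun r v => by
    have := Submodule.mem_orthogonal_singleton_iff_inner_left.1 v.2
    simp [inner_add_left, inner_smul_left, this, hu]
  rw [← hiso.hausdorffMeasure_image (.inl hs)]
  congr 1
  ext x
  constructor
  · rintro ⟨hx, hxt⟩
    obtain ⟨⟨r, v⟩, rfl⟩ := (splitUnit u hu).surjective x
    have : r = t := by simpa only [splitUnit_apply, Set.mem_ofPred_eq, hinner] using hxt
    subst this
    exact ⟨v, hx, rfl⟩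
  · rintro ⟨v, hv, rfl⟩
    exact ⟨hv, hinner t v⟩

end Hyperplane

/-- Bonnesen's inequality for sections: `L = u^⊥` is a linear hyperplane with unit
normal `u`, and `M`, `N` are the maximal `(d-1)`-volumes of sections of `A`, `B`
by affine hyperplanes parallel to `L`. -/
theorem bonnesen_sections (d : ℕ) (hd : 2 ≤ d)
    (u : EuclideanSpace ℝ (Fin d)) (hu : ‖u‖ = 1)
    (A B : Set (EuclideanSpace ℝ (Fin d)))
    (hAc : IsCompact A) (hAcv : Convex ℝ A) (hAi : (interior A).Nonempty)
    (hBc : IsCompact B) (hBcv : Convex ℝ B) (hBi : (interior B).Nonempty)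
    (M N : ℝ)
    (hM : IsGreatest
      (Set.range fun t : ℝ => (μH[(d : ℝ) - 1] (A ∩ {x | ⟪x, u⟫ = t})).toReal) M)
    (hN : IsGreatest
      (Set.range fun t : ℝ => (μH[(d : ℝ) - 1] (B ∩ {x | ⟪x, u⟫ = t})).toReal) N)
    (α β : ℝ) (hα : 0 < α) (hβ : 0 < β) :
    (volume (α • A + β • B)).toReal ≥
      (α * M ^ (1 / ((d : ℝ) - 1)) + β * N ^ (1 / ((d : ℝ) - 1))) ^ (d - 1) *
        (α * (volume A).toReal / M + β * (volume B).toReal / N) := by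
  obtain ⟨m, rfl⟩ := Nat.exists_eq_add_of_le' hd
  have hdim : ((m + 2 : ℕ) : ℝ) - 1 = m + 1 := by push_cast; ring
  have hn : (0 : ℝ) < m + 1 := by positivity
  have hrank : Module.finrank ℝ (ℝ ∙ u)ᗮ = m + 1 :=
    haveI : Fact (Module.finrank ℝ (EuclideanSpace ℝ (Fin (m + 2))) = m + 1 + 1) := ⟨by simp⟩
    Submodule.finrank_orthogonal_span_singleton (norm_ne_zero_iff.1 (by simp [hu]))
  have hsub : m + 2 - 1 = m + 1 := rfl
  rw [hdim, hsub]
  rw [hdim] at hM hN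
  simp only [hausdorffMeasure_slice u hu hn.le] at hM hN
  set ν : Measure (ℝ ∙ u)ᗮ := μH[(m : ℝ) + 1] with hν
  have hHaar : ν.IsAddHaarMeasure := by
    have := isAddHaarMeasure_hausdorffMeasure (E := (ℝ ∙ u)ᗮ)
    rw [hrank] at this
    simpa [hν] using this
  set e := splitUnit u hu
  obtain ⟨c, hc, hvol⟩ := e.exists_measureReal_eq ((volume : Measure ℝ).prod ν) volume
  have hcomp : ∀ {S : Set (EuclideanSpace ℝ (Fin (m + 2)))}, IsCompact S → IsCompact (e ⁻¹' S) :=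
    fun hS => e.toHomeomorph.isCompact_preimage.2 hS
  have hsmul : ∀ (r : ℝ), 0 < r → ∀ S : Set (EuclideanSpace ℝ (Fin (m + 2))),
      e ⁻¹' (r • S) = r • (e ⁻¹' S) := fun r hr S => by
    ext x
    simp [Set.mem_smul_set_iff_inv_smul_mem₀ hr.ne']
  have hpos : ∀ {S : Set (EuclideanSpace ℝ (Fin (m + 2)))} {R : ℝ}, IsCompact S →
      (interior S).Nonempty →
      IsLUB (Set.range fun t : ℝ => ν.real (Prod.mk t ⁻¹' (e ⁻¹' S))) R → 0 < R :=
    fun hS hSi hR => (hcomp hS).slice_lub_pos ν (Measure.measure_pos_of_nonempty_interior _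
      ((hSi.preimage e.surjective).mono (preimage_interior_subset_interior_preimage
        e.continuous))).ne' hR.1
  have hM0 : 0 < M := hpos hAc hAi hM.isLUB
  have hN0 : 0 < N := hpos hBc hBi hN.isLUB
  have hv : ∀ (r : ℝ), 0 < r → ∀ S : Set (EuclideanSpace ℝ (Fin (m + 2))),
      volume.real (r • S) = r ^ (m + 2) * volume.real S := fun r hr S => by
    rw [measureReal_def, Measure.addHaar_smul, ENNReal.toReal_mul,
      ENNReal.toReal_ofReal (abs_nonneg _), abs_of_pos (by positivity), measureReal_def]
    simp
  have hlub : ∀ {S : Set (EuclideanSpace ℝ (Fin (m + 2)))} {R r : ℝ}, 0 < r →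
      IsLUB (Set.range fun t : ℝ => ν.real (Prod.mk t ⁻¹' (e ⁻¹' S))) R →
      IsLUB (Set.range fun t : ℝ => ν.real (Prod.mk t ⁻¹' (e ⁻¹' (r • S))))
        (r ^ (m + 1) * R) := fun {S R r} hr h => by
    rw [hsmul r hr, ← hrank]
    exact isLUB_slice_smul ν hr h
  have key := (brunnMinkowski_of_finrank m ν hrank).bonnesen_prod ν hn
    (hcomp (hAc.smul α)) (hcomp (hBc.smul β)) (by positivity) (by positivity)
    (hlub hα hM.isLUB) (hlub hβ hN.isLUB)
  rw [← e.preimage_add] at key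
  have hroot : ∀ {r R : ℝ}, 0 < r → 0 < R →
      (r ^ (m + 1) * R) ^ (1 / ((m : ℝ) + 1)) = r * R ^ (1 / ((m : ℝ) + 1)) :=
    fun {r R} hr hR => by
    rw [Real.mul_rpow (by positivity) hR.le, ← Real.rpow_natCast, ← Real.rpow_mul hr.le]
    push_cast
    rw [mul_one_div_cancel hn.ne', Real.rpow_one]
  rw [hroot hα hM0, hroot hβ hN0] at key
  have hpow : ∀ x : ℝ, x ^ ((m : ℝ) + 1) = x ^ (m + 1) := fun x => by
    rw [← Real.rpow_natCast]; push_cast; rfl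
  rw [hpow] at key
  have hratio : ∀ {S : Set (EuclideanSpace ℝ (Fin (m + 2)))} {r R : ℝ}, 0 < r → 0 < R →
      c * ((volume.prod ν).real (e ⁻¹' (r • S)) / (r ^ (m + 1) * R))
        = r * (volume S).toReal / R := fun {S r R} hr hR => by
    rw [← mul_div_assoc, ← hvol, hv r hr, measureReal_def]
    field_simp
    ring
  have := mul_le_mul_of_nonneg_left key hc.le
  rw [← hvol, mul_left_comm, mul_add, hratio hα hM0, hratio hβ hN0] at this
  exact this
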